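/- arXiv:2605.31247 — 3 statements merged into one kernel-verified Lean document; each statement's English description precedes it below -/
import Mathlib

section
/- Let d and N be positive integers and let R be a commutative ℂ-algebra graded by the lattice ℤ^d (so R = ⊕_{α ∈ ℤ^d} R_α with R_α · R_β ⊆ R_{α+β}), such that every graded piece R_α is a finite-dimensional ℂ-vector space and R is generated as a ℂ-algebra by homogeneous elements x_1, …, x_N with x_i ∈ R_{α_i} for weights α_1, …, α_N ∈ ℤ^d. If ξ ∈ ℝ^d satisfies ⟨α_i, ξ⟩ > 0 for every i = 1, …, N, then for every complex number t with Re(t) > 0 the family (dim_ℂ R_α · e^{−t⟨α, ξ⟩})_{α ∈ ℤ^d} is summable in ℂ. -/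
/-- The product over coordinates of summable nonnegative functions is summable. -/
theorem summable_fin_prod_of_nonneg {n : ℕ} (f : Fin n → ℕ → ℝ) (hf : ∀ i k, 0 ≤ f i k)
    (hs : ∀ i, Summable (f i)) : Summable fun m : Fin n → ℕ => ∏ i, f i (m i) := by
  induction n with
  | zero => exact Summable.of_finite
  | succ n ih =>
    have h := (hs 0).mul_of_nonneg (ih (fun i => f i.succ) (fun i => hf i.succ) fun i => hs i.succ)
      (hf 0) fun m => Finset.prod_nonneg fun i _ => hf i.succ (m i)
    rw [← (Fin.consEquiv fun _ => ℕ).summable_iff]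
    refine h.congr fun p => ?_
    simp [Fin.prod_univ_succ, Fin.consEquiv]

/-- If a family that depends only on `w m` and is positive is summable, then the fibres of `w`
are finite and the family weighted by their cardinalities is summable. -/
theorem finite_fiber_and_summable_card_mul {ι κ : Type*} (w : ι → κ) (g : κ → ℝ)
    (hg : ∀ a, 0 < g a) (hs : Summable fun m => g (w m)) :
    (∀ a, Finite {m // w m = a}) ∧ Summable fun a => (Nat.card {m // w m = a} : ℝ) * g a := by
  have h := (Equiv.sigmaFiberEquiv w).summable_iff.mpr hs
  have h' : Summable fun p : Σ a, {m // w m = a} => g p.1 :=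
    h.congr fun p => by simp [Equiv.sigmaFiberEquiv, p.2.2]
  have hfin : ∀ a, Finite {m // w m = a} := fun a => by
    by_contra hinf
    rw [not_finite_iff_infinite] at hinf
    exact (hg a).ne' ((summable_const_iff (g a)).mp (h'.sigma_factor a))
  refine ⟨hfin, h'.sigma.congr fun a => ?_⟩
  simp [tsum_const]

/-- Each graded piece is contained in the span of the monomials of that weight. -/
theorem graded_piece_le_span_monomials {ι σ K R : Type*} [AddCommMonoid ι] [DecidableEq ι]
    [Fintype σ] [CommRing K] [CommRing R] [Algebra K R] (𝒜 : ι → Submodule K R) [GradedAlgebra 𝒜]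
    (x : σ → R) (α : σ → ι) (hx : ∀ i, x i ∈ 𝒜 (α i))
    (hgen : Algebra.adjoin K (Set.range x) = ⊤) (a : ι) :
    𝒜 a ≤ Submodule.span K
      ((fun m : σ → ℕ => ∏ i, x i ^ m i) '' {m | ∑ i, m i • α i = a}) := by
  intro r hr
  obtain ⟨p, rfl⟩ : ∃ p : MvPolynomial σ K, MvPolynomial.aeval x p = r := by
    rw [← AlgHom.mem_range, ← Algebra.adjoin_range_eq_range_aeval, hgen]
    exact Algebra.mem_top
  rw [← DirectSum.decompose_of_mem_same 𝒜 hr, ← GradedAlgebra.proj_apply,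
    MvPolynomial.aeval_def, MvPolynomial.eval₂_eq', map_sum]
  refine Submodule.sum_mem _ fun m _ => ?_
  rw [← Algebra.smul_def, map_smul]
  refine Submodule.smul_mem _ _ ?_
  have hm : ∏ i, x i ^ m i ∈ 𝒜 (∑ i, m i • α i) :=
    SetLike.prod_mem_graded _ _ _ fun i _ => SetLike.pow_mem_graded _ (hx i)
  rw [GradedAlgebra.proj_apply]
  by_cases h : ∑ i, m i • α i = a
  · rw [DirectSum.decompose_of_mem_same 𝒜 (h ▸ hm)]
    exact Submodule.subset_span ⟨m, h, rfl⟩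
  · rw [DirectSum.decompose_of_mem_ne 𝒜 hm h]
    exact Submodule.zero_mem _

/-- The dimension of a graded piece is at most the number of monomials of that weight. -/
theorem finrank_graded_piece_le_card {ι σ K R : Type*} [AddCommMonoid ι] [DecidableEq ι]
    [Fintype σ] [Field K] [CommRing R] [Algebra K R] (𝒜 : ι → Submodule K R) [GradedAlgebra 𝒜]
    (x : σ → R) (α : σ → ι) (hx : ∀ i, x i ∈ 𝒜 (α i))
    (hgen : Algebra.adjoin K (Set.range x) = ⊤) (a : ι)
    (hfin : Finite {m : σ → ℕ // ∑ i, m i • α i = a}) :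
    Module.finrank K (𝒜 a) ≤ Nat.card {m : σ → ℕ // ∑ i, m i • α i = a} := by
  classical
  have hS : {m : σ → ℕ | ∑ i, m i • α i = a}.Finite := hfin
  have hle := graded_piece_le_span_monomials 𝒜 x α hx hgen a
  rw [← hS.coe_toFinset, ← Finset.coe_image] at hle
  calc Module.finrank K (𝒜 a) ≤ _ := Submodule.finrank_mono hle
    _ ≤ _ := finrank_span_finset_le_card _
    _ ≤ hS.toFinset.card := Finset.card_image_le
    _ = _ := (Nat.card_eq_card_finite_toFinset hS).symm

/-- Let `R` be a commutative `ℂ`-algebra graded by `ℤ^d` with finite-dimensional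
graded pieces, generated as a `ℂ`-algebra by homogeneous elements of weights
`α 1, …, α N ∈ ℤ^d`.  If `ξ ∈ ℝ^d` pairs strictly positively with every generator
weight (a Reeb vector), then for every complex `t` with `Re t > 0` the family
`(dim_ℂ R_a · e^{−t⟨a, ξ⟩})_{a ∈ ℤ^d}` is summable in `ℂ` (convergence of the
index character). -/
theorem index_character_summable
    {d N : ℕ} (hd : 0 < d) (hN : 0 < N)
    {R : Type*} [CommRing R] [Algebra ℂ R]
    (𝒜 : (Fin d → ℤ) → Submodule ℂ R) [GradedAlgebra 𝒜]
    (hfd : ∀ a : Fin d → ℤ, FiniteDimensional ℂ ↥(𝒜 a))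
    (x : Fin N → R) (α : Fin N → (Fin d → ℤ))
    (hx : ∀ i, x i ∈ 𝒜 (α i))
    (hgen : Algebra.adjoin ℂ (Set.range x) = ⊤)
    (ξ : Fin d → ℝ) (hξ : ∀ i, 0 < ∑ j, (α i j : ℝ) * ξ j)
    (t : ℂ) (ht : 0 < t.re) :
    Summable (fun a : Fin d → ℤ =>
      (Module.finrank ℂ ↥(𝒜 a) : ℂ) *
        Complex.exp (-t * ((∑ j, (a j : ℝ) * ξ j : ℝ) : ℂ))) := by
  set g : (Fin d → ℤ) → ℝ := fun a => Real.exp (-t.re * ∑ j, (a j : ℝ) * ξ j) with hg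
  have hprod : Summable fun m : Fin N → ℕ => g (∑ i, m i • α i) := by
    refine (summable_fin_prod_of_nonneg
      (fun i k => Real.exp (-t.re * ∑ j, (α i j : ℝ) * ξ j) ^ k) (fun i k => by positivity)
      fun i => summable_geometric_of_lt_one (Real.exp_pos _).le ?_).congr fun m => ?_
    · rw [Real.exp_lt_one_iff]
      nlinarith [mul_pos ht (hξ i)]
    · simp only [hg, ← Real.exp_nat_mul, ← Real.exp_sum, Finset.sum_apply, Pi.smul_apply,
        Int.cast_sum, Finset.sum_mul, Finset.mul_sum]
      rw [Finset.sum_comm]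
      congr! 3
      push_cast [nsmul_eq_mul]
      ring
  obtain ⟨hfin, hsum⟩ := finite_fiber_and_summable_card_mul _ g (fun a => Real.exp_pos _) hprod
  refine Summable.of_norm_bounded hsum fun a => ?_
  rw [norm_mul, Complex.norm_natCast, Complex.norm_exp, Complex.re_mul_ofReal, Complex.neg_re]
  gcongr
  exact finrank_graded_piece_le_card 𝒜 x α hx hgen a (hfin a)
end

section
/- Let d and N be positive integers and let R be a commutative ℂ-algebra graded by the lattice ℤ^d (so R = ⊕_{α ∈ ℤ^d} R_α with R_α · R_β ⊆ R_{α+β}), such that every graded piece R_α is a finite-dimensional ℂ-vector space and R is generated as a ℂ-algebra by homogeneous elements x_1, …, x_N with x_i ∈ R_{α_i} for weights α_1, …, α_N ∈ ℤ^d. If ξ ∈ ℝ^d satisfies ⟨α_i, ξ⟩ > 0 for every i = 1, …, N, then for every η ∈ ℝ^d and every complex number t with Re(t) > 0 the family (dim_ℂ R_α · ⟨α, η⟩ · e^{−t⟨α, ξ⟩})_{α ∈ ℤ^d} is summable in ℂ. -/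
theorem summable_prod_pow_of_lt_one : ∀ {n : ℕ} (r : Fin n → ℝ), (∀ i, 0 ≤ r i) → (∀ i, r i < 1) →
    Summable (fun m : Fin n → ℕ => ∏ i, r i ^ m i)
  | 0, _, _, _ => Summable.of_finite
  | n + 1, r, h0, h1 => by
    rw [← (Fin.consEquiv fun _ : Fin (n + 1) => ℕ).summable_iff]
    have key := (summable_geometric_of_lt_one (h0 0) (h1 0)).mul_of_nonneg
      (summable_prod_pow_of_lt_one (fun i => r i.succ) (fun i => h0 _) (fun i => h1 _))
      (fun k => pow_nonneg (h0 0) k)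
      (fun m => Finset.prod_nonneg fun i _ => pow_nonneg (h0 _) _)
    refine key.congr fun p => ?_
    simp [Fin.prod_univ_succ, Fin.consEquiv]

theorem summable_exp_neg_sum_mul {n : ℕ} (c : Fin n → ℝ) (hc : ∀ i, 0 < c i) :
    Summable (fun m : Fin n → ℕ => Real.exp (-∑ i, (m i : ℝ) * c i)) := by
  refine (summable_prod_pow_of_lt_one (fun i => Real.exp (-c i)) (fun i => (Real.exp_pos _).le)
    (fun i => by simpa using hc i)).congr fun m => ?_
  simp [← Real.exp_nat_mul, ← Real.exp_sum]

theorem summable_abs_sum_mul_exp_neg_sum {n : ℕ} (b c : Fin n → ℝ) (hc : ∀ i, 0 < c i) :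
    Summable (fun m : Fin n → ℕ =>
      |∑ i, (m i : ℝ) * b i| * Real.exp (-∑ i, (m i : ℝ) * c i)) := by
  set C := ∑ i, |b i| / c i
  have hb : ∀ i, |b i| ≤ C * c i := fun i => by
    rw [← div_le_iff₀ (hc i)]
    exact Finset.single_le_sum (f := fun i => |b i| / c i)
      (fun j _ => div_nonneg (abs_nonneg _) (hc j).le) (Finset.mem_univ i)
  have hC : 0 ≤ C := Finset.sum_nonneg fun j _ => div_nonneg (abs_nonneg _) (hc j).le
  refine Summable.of_nonneg_of_le (fun m => by positivity) (fun m => ?_)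
    ((summable_exp_neg_sum_mul (fun i => c i / 2) (fun i => half_pos (hc i))).mul_left (2 * C))
  set X := ∑ i, (m i : ℝ) * c i
  have hX : ∑ i, (m i : ℝ) * (c i / 2) = X / 2 := by
    simp only [X, Finset.sum_div, mul_div_assoc]
  have habs : |∑ i, (m i : ℝ) * b i| ≤ C * X := by
    refine (Finset.abs_sum_le_sum_abs _ _).trans ?_
    rw [Finset.mul_sum]
    refine Finset.sum_le_sum fun i _ => ?_
    rw [abs_mul, Nat.abs_cast, mul_left_comm]
    exact mul_le_mul_of_nonneg_left (hb i) (Nat.cast_nonneg _)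
  have hexp : X ≤ 2 * Real.exp (X / 2) := by
    linarith [Real.add_one_le_exp (X / 2)]
  rw [hX]
  calc |∑ i, (m i : ℝ) * b i| * Real.exp (-X)
      ≤ C * (2 * Real.exp (X / 2)) * Real.exp (-X) := by gcongr; exact habs.trans (by gcongr)
    _ = 2 * C * (Real.exp (X / 2) * Real.exp (-X)) := by ring
    _ = 2 * C * Real.exp (-(X / 2)) := by rw [← Real.exp_add]; ring_nf

/-- If every variable has positive weight under `ℓ`, then only finitely many exponents share a
given degree. -/
theorem finite_fiber_of_pos {ι : Type*} {n : ℕ} (deg : (Fin n → ℕ) → ι) (c : Fin n → ℝ)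
    (hc : ∀ i, 0 < c i) (ℓ : ι → ℝ) (hℓ : ∀ m, ℓ (deg m) = ∑ i, (m i : ℝ) * c i) (a : ι) :
    Finite (deg ⁻¹' {a}) := by
  by_contra h
  rw [not_finite_iff_infinite] at h
  have hs : Summable (fun _ : deg ⁻¹' {a} => Real.exp (-ℓ a)) :=
    ((summable_exp_neg_sum_mul c hc).subtype (deg ⁻¹' {a})).congr fun m => by
      simp [← hℓ, show deg m.1 = a from m.2]
  exact (Real.exp_pos _).ne' ((summable_const_iff _).1 hs)

section GradedAlgebra

variable {ι K R : Type*} [DecidableEq ι] [AddCommMonoid ι] [Field K] [CommRing R] [Algebra K R]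
  (𝒜 : ι → Submodule K R) [GradedAlgebra 𝒜] {n : ℕ} {x : Fin n → R} {w : Fin n → ι}

/-- A graded piece of an algebra generated by homogeneous elements is spanned by the monomials in
the generators having the right weight. -/
theorem GradedAlgebra.le_span_monomials (hx : ∀ i, x i ∈ 𝒜 (w i))
    (hgen : Algebra.adjoin K (Set.range x) = ⊤) (a : ι) :
    𝒜 a ≤ Submodule.span K (Set.range
      fun m : (fun m : Fin n → ℕ => ∑ i, m i • w i) ⁻¹' {a} => ∏ i, x i ^ m.1 i) := by
  intro r hr
  have hr' : r ∈ (MvPolynomial.aeval (R := K) x).range := by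
    rw [← Algebra.adjoin_range_eq_range_aeval, hgen]
    trivial
  obtain ⟨p, rfl⟩ : ∃ p, MvPolynomial.aeval x p = r := hr'
  have hproj : GradedAlgebra.proj 𝒜 a (MvPolynomial.aeval x p) = MvPolynomial.aeval x p := by
    rw [GradedAlgebra.proj_apply, DirectSum.decompose_of_mem_same 𝒜 hr]
  rw [← hproj, MvPolynomial.aeval_def, MvPolynomial.eval₂_eq', map_sum]
  refine Submodule.sum_mem _ fun m _ => ?_
  rw [← Algebra.smul_def, map_smul]
  refine Submodule.smul_mem _ _ ?_
  have hm : ∏ i, x i ^ m i ∈ 𝒜 (∑ i, m i • w i) :=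
    SetLike.prod_pow_mem_graded 𝒜 _ _ _ fun i _ => hx i
  rw [GradedAlgebra.proj_apply]
  by_cases h : ∑ i, m i • w i = a
  · rw [DirectSum.decompose_of_mem_same 𝒜 (h ▸ hm)]
    exact Submodule.subset_span ⟨⟨m, h⟩, rfl⟩
  · rw [DirectSum.decompose_of_mem_ne 𝒜 hm h]
    exact Submodule.zero_mem _

theorem GradedAlgebra.finrank_le_card_monomials (hx : ∀ i, x i ∈ 𝒜 (w i))
    (hgen : Algebra.adjoin K (Set.range x) = ⊤) (a : ι)
    [Fintype ((fun m : Fin n → ℕ => ∑ i, m i • w i) ⁻¹' {a})] :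
    Module.finrank K (𝒜 a) ≤ Fintype.card ((fun m : Fin n → ℕ => ∑ i, m i • w i) ⁻¹' {a}) :=
  have := FiniteDimensional.span_of_finite K (Set.finite_range
    fun m : (fun m : Fin n → ℕ => ∑ i, m i • w i) ⁻¹' {a} => ∏ i, x i ^ m.1 i)
  (Submodule.finrank_mono (GradedAlgebra.le_span_monomials 𝒜 hx hgen a)).trans
    (finrank_range_le_card _)

end GradedAlgebra

theorem sum_intCast_sum_smul_mul {d n : ℕ} (w : Fin n → Fin d → ℤ) (ξ : Fin d → ℝ)
    (m : Fin n → ℕ) :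
    ∑ j, (((∑ i, m i • w i) j : ℤ) : ℝ) * ξ j = ∑ i, (m i : ℝ) * ∑ j, (w i j : ℝ) * ξ j := by
  simp only [Finset.sum_apply, nsmul_eq_mul, Int.cast_sum, Finset.sum_mul, Finset.mul_sum]
  rw [Finset.sum_comm]
  simp [mul_assoc]

/-- Let `R` be a commutative `ℂ`-algebra graded by `ℤ^d` with finite-dimensional
graded pieces, generated as a `ℂ`-algebra by homogeneous elements of weights
`α 1, …, α N ∈ ℤ^d`.  If `ξ ∈ ℝ^d` pairs strictly positively with every generator
weight, then for every `η ∈ ℝ^d` and every complex `t` with `Re t > 0` the family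
`(dim_ℂ R_a · ⟨a, η⟩ · e^{−t⟨a, ξ⟩})_{a ∈ ℤ^d}` is summable in `ℂ` (convergence of
the weight character). -/
theorem weight_character_summable
    {d N : ℕ} (hd : 0 < d) (hN : 0 < N)
    {R : Type*} [CommRing R] [Algebra ℂ R]
    (𝒜 : (Fin d → ℤ) → Submodule ℂ R) [GradedAlgebra 𝒜]
    (hfd : ∀ a : Fin d → ℤ, FiniteDimensional ℂ ↥(𝒜 a))
    (x : Fin N → R) (α : Fin N → (Fin d → ℤ))
    (hx : ∀ i, x i ∈ 𝒜 (α i))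
    (hgen : Algebra.adjoin ℂ (Set.range x) = ⊤)
    (ξ : Fin d → ℝ) (hξ : ∀ i, 0 < ∑ j, (α i j : ℝ) * ξ j)
    (η : Fin d → ℝ) (t : ℂ) (ht : 0 < t.re) :
    Summable (fun a : Fin d → ℤ =>
      (Module.finrank ℂ ↥(𝒜 a) : ℂ) * ((∑ j, (a j : ℝ) * η j : ℝ) : ℂ) *
        Complex.exp (-t * ((∑ j, (a j : ℝ) * ξ j : ℝ) : ℂ))) := by
  set deg : (Fin N → ℕ) → (Fin d → ℤ) := fun m => ∑ i, m i • α i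
  set ℓ : (Fin d → ℤ) → ℝ := fun a => ∑ j, (a j : ℝ) * ξ j
  set e : (Fin d → ℤ) → ℝ := fun a => ∑ j, (a j : ℝ) * η j
  have hℓ : ∀ m, ℓ (deg m) = ∑ i, (m i : ℝ) * ℓ (α i) := sum_intCast_sum_smul_mul α ξ
  have he : ∀ m, e (deg m) = ∑ i, (m i : ℝ) * e (α i) := sum_intCast_sum_smul_mul α η
  set h : (Fin d → ℤ) → ℝ := fun a => |e a| * Real.exp (-(t.re * ℓ a))
  have hs : Summable (fun m => h (deg m)) :=
    (summable_abs_sum_mul_exp_neg_sum (fun i => e (α i)) (fun i => t.re * ℓ (α i))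
      (fun i => mul_pos ht (hξ i))).congr fun m => by
        simp only [h, hℓ, he, Finset.mul_sum, mul_left_comm]
  refine Summable.of_norm_bounded (hs.hasSum.tsum_fiberwise deg).summable fun a => ?_
  have := finite_fiber_of_pos deg (fun i => ℓ (α i)) hξ ℓ hℓ a
  have := Fintype.ofFinite (deg ⁻¹' {a})
  have hfib : ∑' m : deg ⁻¹' {a}, h (deg m) = Fintype.card (deg ⁻¹' {a}) * h a := by
    rw [tsum_congr fun m : deg ⁻¹' {a} => congrArg h (show deg m = a from m.2), tsum_fintype,
      Finset.sum_const, nsmul_eq_mul, Finset.card_univ]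
  have hnorm : ‖Complex.exp (-t * (ℓ a : ℂ))‖ = Real.exp (-(t.re * ℓ a)) := by
    simp [Complex.norm_exp]
  rw [hfib, norm_mul, norm_mul, hnorm, Complex.norm_natCast, Complex.norm_real, Real.norm_eq_abs,
    mul_assoc]
  have hcard := GradedAlgebra.finrank_le_card_monomials 𝒜 hx hgen a
  exact mul_le_mul_of_nonneg_right (Nat.cast_le.2 hcard) (by positivity)
end

section
/- Let d and N be positive integers and let R be a commutative ℂ-algebra graded by the lattice ℤ^d, with every graded piece R_α a finite-dimensional ℂ-vector space, generated as a ℂ-algebra by homogeneous elements x_1, …, x_N of weights α_1, …, α_N ∈ ℤ^d. Assume that the set of weights {α ∈ ℤ^d : R_α ≠ 0} spans ℝ^d. Then for every fixed real t > 0, the function ξ ↦ F(ξ, t) = Σ_{α ∈ ℤ^d} (dim_ℂ R_α) e^{−t⟨α, ξ⟩} is strictly convex on the open convex cone C_R = {ξ ∈ ℝ^d : ⟨α_i, ξ⟩ > 0 for all i = 1, …, N}. -/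
/-- A product of nonnegative summable families is summable over the product index type. -/
theorem summable_pi_prod_of_nonneg {ι : Type*} [Fintype ι] [DecidableEq ι]
    {f : ι → ℕ → ℝ} (h0 : ∀ i k, 0 ≤ f i k) (hf : ∀ i, Summable (f i)) :
    Summable fun m : ι → ℕ => ∏ i, f i (m i) := by
  refine summable_of_sum_le (c := ∏ i, ∑' k, f i k)
    (fun m => Finset.prod_nonneg fun i _ => h0 i _) fun s => ?_
  have hs : s ⊆ Fintype.piFinset fun i => s.image fun m => m i := fun m hm =>
    Fintype.mem_piFinset.2 fun i => Finset.mem_image_of_mem (fun m : ι → ℕ => m i) hm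
  calc ∑ m ∈ s, ∏ i, f i (m i)
      ≤ ∑ m ∈ Fintype.piFinset fun i => s.image fun m => m i, ∏ i, f i (m i) :=
        Finset.sum_le_sum_of_subset_of_nonneg hs
          fun m _ _ => Finset.prod_nonneg fun i _ => h0 i _
    _ = ∏ i, ∑ k ∈ s.image fun m => m i, f i k := (Finset.prod_univ_sum _ _).symm
    _ ≤ ∏ i, ∑' k, f i k :=
        Finset.prod_le_prod (fun i _ => Finset.sum_nonneg fun k _ => h0 i k)
          fun i _ => (hf i).sum_le_tsum _ fun k _ => h0 i k

section GradedMonomials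

variable {ι κ K R : Type*} [AddCommMonoid ι] [DecidableEq ι] [Fintype κ] [Field K] [CommRing R]
  [Algebra K R] (𝒜 : ι → Submodule K R) [GradedAlgebra 𝒜] {x : κ → R} {α : κ → ι}

/-- A graded piece is spanned by the monomials of its weight in homogeneous generators. -/
theorem graded_eq_span_monomials (hx : ∀ i, x i ∈ 𝒜 (α i))
    (hgen : Algebra.adjoin K (Set.range x) = ⊤) (a : ι) :
    𝒜 a = Submodule.span K
      ((fun m : κ → ℕ => ∏ i, x i ^ m i) '' {m | ∑ i, m i • α i = a}) := by
  classical
  have hmem : ∀ m : κ → ℕ, ∏ i, x i ^ m i ∈ 𝒜 (∑ i, m i • α i) := fun m =>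
    SetLike.prod_mem_graded _ _ _ fun i _ => SetLike.pow_mem_graded _ (hx i)
  apply le_antisymm
  · intro r hr
    have hmon : ∀ y ∈ Submonoid.closure (Set.range x), ∃ m : κ → ℕ, y = ∏ i, x i ^ m i := by
      intro y hy
      induction hy using Submonoid.closure_induction with
      | mem y hy =>
        obtain ⟨i, rfl⟩ := hy
        exact ⟨Pi.single i 1, by simp [Pi.single_apply, pow_ite]⟩
      | one => exact ⟨0, by simp⟩
      | mul y z _ _ hy hz =>
        obtain ⟨m, rfl⟩ := hy
        obtain ⟨n, rfl⟩ := hz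
        exact ⟨m + n, by simp [pow_add, Finset.prod_mul_distrib]⟩
    have hproj : ∀ y ∈ Submodule.span K (Submonoid.closure (Set.range x) : Set R),
        (DirectSum.decompose 𝒜 y a : R) ∈ Submodule.span K
          ((fun m : κ → ℕ => ∏ i, x i ^ m i) '' {m | ∑ i, m i • α i = a}) := by
      intro y hy
      induction hy using Submodule.span_induction with
      | mem y hy =>
        obtain ⟨m, rfl⟩ := hmon y hy
        by_cases h : ∑ i, m i • α i = a
        · rw [DirectSum.decompose_of_mem_same 𝒜 (h ▸ hmem m)]
          exact Submodule.subset_span ⟨m, h, rfl⟩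
        · rw [DirectSum.decompose_of_mem_ne 𝒜 (hmem m) h]
          exact Submodule.zero_mem _
      | zero => simp
      | add y z _ _ hy hz => simpa using Submodule.add_mem _ hy hz
      | smul c y _ hy =>
        rw [DirectSum.decompose_smul, DirectSum.smul_apply]
        exact Submodule.smul_mem _ c hy
    have hr' := hproj r (by rw [← Algebra.adjoin_eq_span, hgen]; trivial)
    rwa [DirectSum.decompose_of_mem_same 𝒜 hr] at hr'
  · rw [Submodule.span_le]
    rintro _ ⟨m, rfl, rfl⟩
    exact hmem m

/-- The dimension of a graded piece is the number of elements of some set of exponents of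
monomials of its weight. -/
theorem exists_finset_exponents_card_eq_finrank (hx : ∀ i, x i ∈ 𝒜 (α i))
    (hgen : Algebra.adjoin K (Set.range x) = ⊤) (a : ι) [FiniteDimensional K (𝒜 a)] :
    ∃ T : Finset (κ → ℕ), T.card = Module.finrank K (𝒜 a) ∧ ∀ m ∈ T, ∑ i, m i • α i = a := by
  classical
  have h := graded_eq_span_monomials 𝒜 hx hgen a
  have : FiniteDimensional K (Submodule.span K
      ((fun m : κ → ℕ => ∏ i, x i ^ m i) '' {m | ∑ i, m i • α i = a})) := h ▸ inferInstance
  obtain ⟨f, hf, -, hli⟩ := Submodule.exists_fun_fin_finrank_span_eq K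
    ((fun m : κ → ℕ => ∏ i, x i ^ m i) '' {m | ∑ i, m i • α i = a})
  choose g hg hgf using hf
  have hinj : Function.Injective g := fun i j hij =>
    hli.injective (by rw [← hgf i, ← hgf j, hij])
  refine ⟨Finset.univ.image g, ?_, ?_⟩
  · rw [Finset.card_image_of_injective _ hinj, Finset.card_univ, Fintype.card_fin, ← h]
  · intro m hm
    obtain ⟨i, -, rfl⟩ := Finset.mem_image.1 hm
    exact hg i

end GradedMonomials

/-- The index character converges on the open Reeb cone. -/
theorem summable_index_character {d N : ℕ} {R : Type*} [CommRing R] [Algebra ℂ R]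
    (𝒜 : (Fin d → ℤ) → Submodule ℂ R) [GradedAlgebra 𝒜]
    (hfd : ∀ a : Fin d → ℤ, FiniteDimensional ℂ ↥(𝒜 a))
    {x : Fin N → R} {α : Fin N → (Fin d → ℤ)} (hx : ∀ i, x i ∈ 𝒜 (α i))
    (hgen : Algebra.adjoin ℂ (Set.range x) = ⊤) {t : ℝ} (ht : 0 < t) {ξ : Fin d → ℝ}
    (hξ : ∀ i, 0 < ∑ j, (α i j : ℝ) * ξ j) :
    Summable fun a : Fin d → ℤ =>
      (Module.finrank ℂ ↥(𝒜 a) : ℝ) * Real.exp (-t * ∑ j, (a j : ℝ) * ξ j) := by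
  classical
  choose T hcard hT using fun a => exists_finset_exponents_card_eq_finrank 𝒜 hx hgen a
  have hsum : Summable fun m : Fin N → ℕ =>
      ∏ i, Real.exp (-t * ∑ j, (α i j : ℝ) * ξ j) ^ m i :=
    summable_pi_prod_of_nonneg (fun i k => by positivity) fun i =>
      summable_geometric_of_lt_one (Real.exp_pos _).le
        (Real.exp_lt_one_iff.2 (by have := mul_pos ht (hξ i); linarith))
  have hexp : ∀ m : Fin N → ℕ, ∏ i, Real.exp (-t * ∑ j, (α i j : ℝ) * ξ j) ^ m i =
      Real.exp (-t * ∑ j, ((∑ i, m i • α i : Fin d → ℤ) j : ℝ) * ξ j) := by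
    intro m
    simp_rw [← Real.exp_nat_mul]
    rw [← Real.exp_sum]
    congr 1
    simp only [Finset.sum_apply, Pi.smul_apply, Int.cast_sum,
      Finset.sum_mul, Finset.mul_sum]
    rw [Finset.sum_comm]
    exact Finset.sum_congr rfl fun j _ => Finset.sum_congr rfl fun i _ => by
      rw [nsmul_eq_mul, Int.cast_mul, Int.cast_natCast]
      ring
  refine summable_of_sum_le
    (c := ∑' m : Fin N → ℕ, ∏ i, Real.exp (-t * ∑ j, (α i j : ℝ) * ξ j) ^ m i)
    (fun a => by positivity) fun s => ?_
  have hdisj : (s : Set (Fin d → ℤ)).PairwiseDisjoint T := fun a _ b _ hab =>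
    Finset.disjoint_left.2 fun m hma hmb => hab ((hT a m hma).symm.trans (hT b m hmb))
  calc ∑ a ∈ s, (Module.finrank ℂ ↥(𝒜 a) : ℝ) * Real.exp (-t * ∑ j, (a j : ℝ) * ξ j)
      = ∑ a ∈ s, ∑ m ∈ T a, ∏ i, Real.exp (-t * ∑ j, (α i j : ℝ) * ξ j) ^ m i := by
        refine Finset.sum_congr rfl fun a _ => ?_
        rw [← hcard a, ← nsmul_eq_mul, ← Finset.sum_const]
        exact Finset.sum_congr rfl fun m hm => by rw [hexp, hT a m hm]
    _ = ∑ m ∈ s.biUnion T, ∏ i, Real.exp (-t * ∑ j, (α i j : ℝ) * ξ j) ^ m i :=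
        (Finset.sum_biUnion hdisj).symm
    _ ≤ _ := hsum.sum_le_tsum _ fun m _ => by positivity


/-- Let `R` be a commutative `ℂ`-algebra graded by `ℤ^d` with finite-dimensional
graded pieces, generated as a `ℂ`-algebra by homogeneous elements of weights
`α 1, …, α N ∈ ℤ^d`, and assume that the weights of the nonzero graded pieces span
`ℝ^d`.  Then for every fixed real `t > 0`, the index character
`ξ ↦ F(ξ, t) = Σ_a (dim_ℂ R_a) e^{−t⟨a, ξ⟩}` is strictly convex on the open Reeb
cone `C_R = {ξ : ⟨α i, ξ⟩ > 0 for all i}`. -/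
theorem index_character_strictConvexOn
    {d N : ℕ} (hd : 0 < d) (hN : 0 < N)
    {R : Type*} [CommRing R] [Algebra ℂ R]
    (𝒜 : (Fin d → ℤ) → Submodule ℂ R) [GradedAlgebra 𝒜]
    (hfd : ∀ a : Fin d → ℤ, FiniteDimensional ℂ ↥(𝒜 a))
    (x : Fin N → R) (α : Fin N → (Fin d → ℤ))
    (hx : ∀ i, x i ∈ 𝒜 (α i))
    (hgen : Algebra.adjoin ℂ (Set.range x) = ⊤)
    (hspan : Submodule.span ℝ
        ((fun a : Fin d → ℤ => (fun j => (a j : ℝ))) '' {a | 𝒜 a ≠ ⊥}) = ⊤)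
    (t : ℝ) (ht : 0 < t) :
    StrictConvexOn ℝ {ξ : Fin d → ℝ | ∀ i, 0 < ∑ j, (α i j : ℝ) * ξ j}
      (fun ξ : Fin d → ℝ => ∑' a : Fin d → ℤ,
        (Module.finrank ℂ ↥(𝒜 a) : ℝ) * Real.exp (-t * ∑ j, (a j : ℝ) * ξ j)) := by
  have hlin : ∀ (a : Fin d → ℤ) (p q : ℝ) (ξ η : Fin d → ℝ),
      ∑ j, (a j : ℝ) * (p • ξ + q • η) j =
        p * ∑ j, (a j : ℝ) * ξ j + q * ∑ j, (a j : ℝ) * η j := by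
    intro a p q ξ η
    simp only [Pi.add_apply, Pi.smul_apply, smul_eq_mul, Finset.mul_sum,
      ← Finset.sum_add_distrib]
    exact Finset.sum_congr rfl fun j _ => by ring
  have hconv : Convex ℝ {ξ : Fin d → ℝ | ∀ i, 0 < ∑ j, (α i j : ℝ) * ξ j} := by
    intro ξ hξ η hη p q hp hq hpq i
    rw [hlin]
    exact convex_Ioi (0 : ℝ) (hξ i) (hη i) hp hq hpq
  refine ⟨hconv, fun ξ hξ η hη hne p q hp hq hpq => ?_⟩
  have hsξ := summable_index_character 𝒜 hfd hx hgen ht hξ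
  have hsη := summable_index_character 𝒜 hfd hx hgen ht hη
  have hsm := summable_index_character 𝒜 hfd hx hgen ht (hconv hξ hη hp.le hq.le hpq)
  obtain ⟨a, ha, hane⟩ : ∃ a, 𝒜 a ≠ ⊥ ∧ ∑ j, (a j : ℝ) * ξ j ≠ ∑ j, (a j : ℝ) * η j := by
    by_contra! hcon
    apply hne
    have hz : ∀ v : Fin d → ℝ, v ⬝ᵥ (ξ - η) = 0 := by
      intro v
      have hv : v ∈ Submodule.span ℝ
          ((fun a : Fin d → ℤ => (fun j => (a j : ℝ))) '' {a | 𝒜 a ≠ ⊥}) := hspan ▸ trivial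
      induction hv using Submodule.span_induction with
      | mem v hv =>
        obtain ⟨a, ha, rfl⟩ := hv
        rw [dotProduct_sub, sub_eq_zero]
        exact hcon a ha
      | zero => simp
      | add v w _ _ hv hw => rw [add_dotProduct, hv, hw, add_zero]
      | smul c v _ hv => rw [smul_dotProduct, hv, smul_zero]
    exact sub_eq_zero.1 (dotProduct_self_eq_zero.1 (hz _))
  have harg : ∀ b : Fin d → ℤ, -t * ∑ j, (b j : ℝ) * (p • ξ + q • η) j =
      p • (-t * ∑ j, (b j : ℝ) * ξ j) + q • (-t * ∑ j, (b j : ℝ) * η j) := by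
    intro b
    rw [hlin, smul_eq_mul, smul_eq_mul]
    ring
  simp only [smul_eq_mul]
  rw [← tsum_mul_left, ← tsum_mul_left,
    ← (hsξ.mul_left p).tsum_add (hsη.mul_left q)]
  refine Summable.tsum_lt_tsum (i := a) (fun b => ?_) ?_ hsm
    ((hsξ.mul_left p).add (hsη.mul_left q))
  · have h := convexOn_exp.2 (Set.mem_univ (-t * ∑ j, (b j : ℝ) * ξ j))
      (Set.mem_univ (-t * ∑ j, (b j : ℝ) * η j)) hp.le hq.le hpq
    rw [← harg, smul_eq_mul, smul_eq_mul] at h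
    exact (mul_le_mul_of_nonneg_left h (Nat.cast_nonneg _)).trans_eq (by ring)
  · have h := strictConvexOn_exp.2 (Set.mem_univ (-t * ∑ j, (a j : ℝ) * ξ j))
      (Set.mem_univ (-t * ∑ j, (a j : ℝ) * η j))
      (fun h => hane (mul_left_cancel₀ (neg_ne_zero.2 ht.ne') h)) hp hq hpq
    rw [← harg, smul_eq_mul, smul_eq_mul] at h
    have hpos : 0 < Module.finrank ℂ (𝒜 a) :=
      Nat.pos_of_ne_zero fun h0 => ha (Submodule.finrank_eq_zero.1 h0)
    exact (mul_lt_mul_of_pos_left h (Nat.cast_pos.2 hpos)).trans_eq (by ring)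
end
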